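/- arXiv:2408.06757 — 2 statements merged into one kernel-verified Lean document; each statement's English description precedes it below -/
import Mathlib

section
/- Let V be a closed subspace of L²(ℝⁿ) such that T_s^θ f ∈ V for every f ∈ V and every s ∈ ℝⁿ. Then there exists a measurable set Ω ⊆ ℝⁿ such that V = { f ∈ L²(ℝⁿ) : F_θ f(ω) = 0 for almost every ω ∈ ℝⁿ ∖ Ω }, where F_θ denotes the unitary extension of the fractional Fourier transform to L²(ℝⁿ). -/
noncomputable section

open MeasureTheory Complex
open scoped InnerProductSpace ENNReal

abbrev Rn (n : ℕ) : Type := EuclideanSpace ℝ (Fin n)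

variable {n : ℕ}

/-- θ-translation: `T_s^θ f (t) = e^{-2πi (s·(t-s)) cot θ} f (t-s)`. -/
def thetaTrans (θ : ℝ) (s : Rn n) (f : Rn n → ℂ) : Rn n → ℂ :=
  fun t => Complex.exp (((-2 * Real.pi * ⟪s, t - s⟫_ℝ * Real.cot θ : ℝ) : ℂ) * Complex.I) * f (t - s)

lemma memℒp_thetaTrans (θ : ℝ) (s : Rn n) (f : Rn n → ℂ)
    (hf : MemLp f 2 (volume : Measure (Rn n))) :
    MemLp (thetaTrans θ s f) 2 (volume : Measure (Rn n)) := by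
  have htr : MemLp (fun t : Rn n => f (t - s)) 2 (volume : Measure (Rn n)) :=
    hf.comp_measurePreserving (measurePreserving_sub_right volume s)
  have hcont : Continuous fun t : Rn n =>
      Complex.exp (((-2 * Real.pi * ⟪s, t - s⟫_ℝ * Real.cot θ : ℝ) : ℂ) * Complex.I) :=
    Complex.continuous_exp.comp
      ((Complex.continuous_ofReal.comp
        ((continuous_const.mul
          (continuous_const.inner ((continuous_id (X := Rn n)).sub continuous_const))).mul
          continuous_const)).mul continuous_const)
  refine ⟨hcont.aestronglyMeasurable.mul htr.1, ?_⟩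
  have heq : eLpNorm (thetaTrans θ s f) 2 (volume : Measure (Rn n)) =
      eLpNorm (fun t : Rn n => f (t - s)) 2 volume := by
    refine eLpNorm_congr_norm_ae (Filter.Eventually.of_forall fun t => ?_)
    show ‖Complex.exp (((-2 * Real.pi * ⟪s, t - s⟫_ℝ * Real.cot θ : ℝ) : ℂ) * Complex.I) *
        f (t - s)‖ = ‖f (t - s)‖
    rw [norm_mul, Complex.norm_exp_ofReal_mul_I, one_mul]
  exact heq ▸ htr.2

/-- θ-translation as a map on `L²(ℝⁿ)`. -/
def thetaTransLp (θ : ℝ) (s : Rn n) (f : Lp ℂ 2 (volume : Measure (Rn n))) :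
    Lp ℂ 2 (volume : Measure (Rn n)) :=
  (memℒp_thetaTrans θ s f (Lp.memLp f)).toLp (thetaTrans θ s f)

/-- Fractional Fourier transform (integral form, for integrable `f`). -/
def frft (θ : ℝ) (f : Rn n → ℂ) : Rn n → ℂ :=
  fun ω => ((|Real.sin θ| ^ (-(n : ℝ) / 2) : ℝ) : ℂ) *
    ∫ t, f t * Complex.exp
      (((Real.pi * ((⟪t, t⟫_ℝ + ⟪ω, ω⟫_ℝ) * Real.cot θ - 2 * ⟪ω, t⟫_ℝ / Real.sin θ) : ℝ) : ℂ) *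
        Complex.I)

/-- `F` is the unitary extension of the fractional Fourier transform to `L²(ℝⁿ)`:
a unitary operator on `L²(ℝⁿ)` agreeing with the integral formula on `L¹ ∩ L²`. -/
def IsFrftL2 (θ : ℝ)
    (F : Lp ℂ 2 (volume : Measure (Rn n)) ≃ₗᵢ[ℂ] Lp ℂ 2 (volume : Measure (Rn n))) : Prop :=
  ∀ (f : Rn n → ℂ) (hf : MemLp f 2 (volume : Measure (Rn n))),
    Integrable f (volume : Measure (Rn n)) →
      (F (hf.toLp f) : Rn n → ℂ) =ᵐ[(volume : Measure (Rn n))] frft θ f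

open scoped ComplexConjugate

section General

open scoped FourierTransform ContDiff

variable {E : Type*} [NormedAddCommGroup E] [InnerProductSpace ℝ E] [FiniteDimensional ℝ E]
  [MeasurableSpace E] [BorelSpace E]

/-- An integrable function whose Fourier transform vanishes identically vanishes almost
everywhere. -/
lemma ae_eq_zero_of_fourier_eq_zero {f : E → ℂ} (hf : Integrable f) (h : ∀ w, 𝓕 f w = 0) :
    ∀ᵐ x, f x = 0 := by
  refine ae_eq_zero_of_integral_contDiff_smul_eq_zero hf.locallyIntegrable fun g hg hgs => ?_
  have hgs' : HasCompactSupport (fun x => (g x : ℂ)) :=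
    hgs.comp_left (g := fun r : ℝ => (r : ℂ)) Complex.ofReal_zero
  have hg' : ContDiff ℝ ∞ (fun x => (g x : ℂ)) := Complex.ofRealCLM.contDiff.comp hg
  let φ : SchwartzMap E ℂ := 𝓕⁻ (hgs'.toSchwartzMap hg')
  have hφ : ∀ x, 𝓕 (φ : E → ℂ) x = g x := fun x => by
    rw [← SchwartzMap.fourier_coe, FourierTransform.fourier_fourierInv_eq]
    rfl
  have key : ∫ ξ, 𝓕 f ξ * φ ξ = ∫ x, f x * 𝓕 (φ : E → ℂ) x := by
    simpa using! VectorFourier.integral_bilin_fourierIntegral_eq_flip (ContinuousLinearMap.mul ℂ ℂ)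
      (L := innerₗ E) Real.continuous_fourierChar continuous_inner hf φ.integrable
  simp only [h, zero_mul, integral_zero, hφ] at key
  rw [key]
  exact integral_congr_ae (.of_forall fun x => by simp [mul_comm])

/-- There is a nowhere vanishing square integrable function. -/
lemma exists_memLp_two_forall_ne_zero :
    ∃ φ : E → ℂ, MemLp φ 2 volume ∧ ∀ x, φ x ≠ 0 := by
  refine ⟨fun v => cexp (-(1 : ℂ) * ‖v‖ ^ 2), ?_, fun x => Complex.exp_ne_zero _⟩
  rw [memLp_two_iff_integrable_sq_norm (by fun_prop)]
  have h := GaussianFourier.integrable_cexp_neg_mul_sq_norm_add (V := E) (b := 2)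
    (by norm_num) 0 0
  refine h.norm.congr (.of_forall fun v => ?_)
  simp only [Complex.norm_exp, ← Real.exp_nat_mul]
  congr 1
  simp [← Complex.ofReal_pow]

/-- A closed subspace `W` of `L²` such that elements of `W` and of `Wᗮ` have almost disjoint
supports consists of all functions vanishing outside some measurable set. -/
lemma exists_measurableSet_of_disjoint_supports
    (W : Submodule ℂ (Lp ℂ 2 (volume : Measure E)))
    (hW : IsClosed (W : Set (Lp ℂ 2 (volume : Measure E))))
    (hdisj : ∀ g ∈ W, ∀ h ∈ Wᗮ, ∀ᵐ x, conj (h x) * g x = 0) :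
    ∃ Ω : Set E, MeasurableSet Ω ∧ ∀ f, f ∈ W ↔ ∀ᵐ x, x ∉ Ω → f x = 0 := by
  have : CompleteSpace W := hW.completeSpace_coe
  obtain ⟨φ, hφ, hφ0⟩ := exists_memLp_two_forall_ne_zero (E := E)
  obtain ⟨g, hg, h, hh, hsum⟩ := W.exists_add_mem_mem_orthogonal (hφ.toLp φ)
  have hsum' : ∀ᵐ x, φ x = g x + h x := by
    have := Lp.coeFn_add g h
    rw [← hsum] at this
    filter_upwards [this, hφ.coeFn_toLp] with x h1 h2
    rw [← h2, h1, Pi.add_apply]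
  refine ⟨Function.support g, (Lp.stronglyMeasurable g).measurableSet_support,
    fun f => ⟨fun hf => ?_, fun hf => ?_⟩⟩
  · filter_upwards [hdisj f hf h hh, hsum'] with x h1 h2 hx
    have hgx : g x = 0 := by simpa using hx
    have hhx : h x ≠ 0 := by
      have := hφ0 x
      rwa [h2, hgx, zero_add] at this
    simpa [hhx] using h1
  · rw [← W.orthogonal_orthogonal]
    intro k hk
    rw [L2.inner_def]
    refine integral_eq_zero_of_ae ?_
    filter_upwards [hdisj g hg k hk, hf] with x h1 h2
    by_cases hx : g x = 0
    · simp [h2 (by simpa using hx)]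
    · have : k x = 0 := by simpa [hx] using h1
      simp [this]

/-- A weighted composition operator on `L²` with unimodular weight and measure preserving
substitution is an isometry. -/
lemma isometry_of_coeFn_eq_mul_comp
    {U : Lp ℂ 2 (volume : Measure E) → Lp ℂ 2 (volume : Measure E)} {τ : E → E} {u : E → ℂ}
    (hτ : MeasurePreserving τ) (hu : ∀ x, ‖u x‖ = 1)
    (hU : ∀ f, U f =ᵐ[volume] fun x => u x * f (τ x)) : Isometry U := by
  intro f g
  rw [Lp.edist_def, Lp.edist_def, ← eLpNorm_comp_measurePreserving
    ((Lp.aestronglyMeasurable f).sub (Lp.aestronglyMeasurable g)) hτ]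
  refine eLpNorm_congr_norm_ae ?_
  filter_upwards [hU f, hU g] with x hf hg
  simp [hf, hg, ← mul_sub, hu]

end General

/-- The unimodular factor by which `F_θ` intertwines `T_s^θ`. -/
def thetaChar (θ : ℝ) (s ω : Rn n) : ℂ :=
  cexp (((Real.pi * (⟪s, s⟫_ℝ * Real.cot θ - 2 * ⟪ω, s⟫_ℝ / Real.sin θ) : ℝ) : ℂ) * I)

lemma norm_thetaChar (θ : ℝ) (s ω : Rn n) : ‖thetaChar θ s ω‖ = 1 :=
  Complex.norm_exp_ofReal_mul_I _

lemma continuous_thetaChar (θ : ℝ) (s : Rn n) : Continuous (thetaChar θ s) := by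
  unfold thetaChar
  fun_prop

lemma frft_thetaTrans (θ : ℝ) (s : Rn n) (f : Rn n → ℂ) (ω : Rn n) :
    frft θ (thetaTrans θ s f) ω = thetaChar θ s ω * frft θ f ω := by
  unfold frft
  rw [mul_left_comm]
  congr 1
  rw [← integral_const_mul, ← integral_add_right_eq_self _ s]
  refine integral_congr_ae (.of_forall fun t => ?_)
  simp only [thetaTrans, thetaChar, add_sub_cancel_right]
  rw [mul_right_comm, ← Complex.exp_add, mul_left_comm, ← Complex.exp_add, mul_comm]
  congr 2
  rw [← add_mul, ← add_mul, ← Complex.ofReal_add, ← Complex.ofReal_add]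
  congr 2
  simp only [inner_add_left, inner_add_right, real_inner_comm s t]
  ring

lemma coeFn_thetaTransLp (θ : ℝ) (s : Rn n) (f : Lp ℂ 2 (volume : Measure (Rn n))) :
    thetaTransLp θ s f =ᵐ[volume] thetaTrans θ s f :=
  MemLp.coeFn_toLp _

lemma thetaTrans_congr_ae (θ : ℝ) (s : Rn n) {f g : Rn n → ℂ} (h : f =ᵐ[volume] g) :
    thetaTrans θ s f =ᵐ[volume] thetaTrans θ s g := by
  filter_upwards [(measurePreserving_sub_right volume s).quasiMeasurePreserving.ae h] with t ht
  simp only [thetaTrans, ht]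

lemma integrable_thetaTrans (θ : ℝ) (s : Rn n) {f : Rn n → ℂ} (hf : Integrable f)
    (hf' : MemLp f 2 volume) : Integrable (thetaTrans θ s f) :=
  (hf.comp_sub_right s).congr' (memℒp_thetaTrans θ s f hf').1
    (.of_forall fun t => by simp only [thetaTrans, norm_mul, Complex.norm_exp_ofReal_mul_I, one_mul])

lemma isometry_thetaTransLp (θ : ℝ) (s : Rn n) :
    Isometry (thetaTransLp θ s : Lp ℂ 2 (volume : Measure (Rn n)) → _) :=
  isometry_of_coeFn_eq_mul_comp (measurePreserving_sub_right volume s)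
    (fun _ => Complex.norm_exp_ofReal_mul_I _) (coeFn_thetaTransLp θ s)

lemma memLp_thetaChar_mul (θ : ℝ) (s : Rn n) {f : Rn n → ℂ} (hf : MemLp f 2 volume) :
    MemLp (fun ω => thetaChar θ s ω * f ω) 2 volume :=
  hf.congr_norm ((continuous_thetaChar θ s).aestronglyMeasurable.mul hf.1)
    (.of_forall fun ω => by rw [norm_mul, norm_thetaChar, one_mul])

/-- `F_θ` turns `T_s^θ` into multiplication by `thetaChar θ s`. -/
lemma IsFrftL2.coeFn_thetaTransLp {θ : ℝ}
    {F : Lp ℂ 2 (volume : Measure (Rn n)) ≃ₗᵢ[ℂ] Lp ℂ 2 (volume : Measure (Rn n))}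
    (hF : IsFrftL2 θ F) (s : Rn n) (f : Lp ℂ 2 (volume : Measure (Rn n))) :
    F (thetaTransLp θ s f) =ᵐ[volume] fun ω => thetaChar θ s ω * F f ω := by
  let M : Lp ℂ 2 (volume : Measure (Rn n)) → Lp ℂ 2 (volume : Measure (Rn n)) := fun g =>
    (memLp_thetaChar_mul θ s (Lp.memLp g)).toLp _
  have hM : ∀ g, M g =ᵐ[volume] fun ω => thetaChar θ s ω * g ω := fun g => MemLp.coeFn_toLp _
  have hMiso : Isometry M :=
    isometry_of_coeFn_eq_mul_comp (MeasurePreserving.id volume) (norm_thetaChar θ s) hM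
  suffices (fun g => F (thetaTransLp θ s g)) = fun g => M (F g) by
    rw [show F (thetaTransLp θ s f) = M (F f) from congrFun this f]
    exact hM _
  refine (SchwartzMap.denseRange_toLpCLM (F := ℂ) (E := Rn n) (p := 2) (μ := volume)
    ENNReal.ofNat_ne_top).equalizer
    (F.continuous.comp (isometry_thetaTransLp θ s).continuous)
    (hMiso.continuous.comp F.continuous) (funext fun φ => ?_)
  have hφ : MemLp φ 2 (volume : Measure (Rn n)) := φ.memLp 2
  have hT : thetaTransLp θ s (hφ.toLp φ) = (memℒp_thetaTrans θ s φ hφ).toLp _ :=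
    MemLp.toLp_congr _ _ (thetaTrans_congr_ae θ s hφ.coeFn_toLp)
  change F (thetaTransLp θ s (hφ.toLp φ)) = M (F (hφ.toLp φ))
  rw [hT]
  refine Lp.ext ?_
  filter_upwards [hF _ (memℒp_thetaTrans θ s φ hφ) (integrable_thetaTrans θ s φ.integrable hφ),
    hF _ hφ φ.integrable, hM (F (hφ.toLp φ))] with ω h1 h2 h3
  rw [h1, h3, h2, frft_thetaTrans]

/-- An integrable function whose integral against every `thetaChar θ s` is zero vanishes almost
everywhere. -/
lemma ae_eq_zero_of_integral_thetaChar_mul_eq_zero {θ : ℝ} (hθ : Real.sin θ ≠ 0) {f : Rn n → ℂ}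
    (hf : Integrable f) (h : ∀ s, ∫ ω, thetaChar θ s ω * f ω = 0) : ∀ᵐ ω, f ω = 0 := by
  refine ae_eq_zero_of_fourier_eq_zero hf fun w => ?_
  have hs := h (Real.sin θ • w)
  have hfac : ∀ ω : Rn n, thetaChar θ (Real.sin θ • w) ω * f ω =
      cexp (((Real.pi * (⟪Real.sin θ • w, Real.sin θ • w⟫_ℝ * Real.cot θ) : ℝ) : ℂ) * I) *
        (cexp (((-2 * Real.pi * ⟪ω, w⟫_ℝ : ℝ) : ℂ) * I) • f ω) := fun ω => by
    rw [smul_eq_mul, ← mul_assoc, ← Complex.exp_add, ← add_mul, ← Complex.ofReal_add, thetaChar]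
    congr 5
    rw [real_inner_smul_right ω]
    field_simp
    ring
  simp only [hfac, integral_const_mul, mul_eq_zero, Complex.exp_ne_zero, false_or] at hs
  rw [Real.fourier_eq', ← hs]

/-- If a closed subspace `V ⊆ L²(ℝⁿ)` is invariant under all
θ-translations, then `V = {f : F_θ f = 0 a.e. on ℝⁿ ∖ Ω}` for some measurable `Ω ⊆ ℝⁿ`. -/
theorem statement16 (n : ℕ) (hn : 1 ≤ n) (θ : ℝ) (hθ : Real.sin θ ≠ 0)
    (F : Lp ℂ 2 (volume : Measure (Rn n)) ≃ₗᵢ[ℂ] Lp ℂ 2 (volume : Measure (Rn n)))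
    (hF : IsFrftL2 θ F)
    (V : Submodule ℂ (Lp ℂ 2 (volume : Measure (Rn n))))
    (hVclosed : IsClosed (V : Set (Lp ℂ 2 (volume : Measure (Rn n)))))
    (hVinv : ∀ f : Lp ℂ 2 (volume : Measure (Rn n)), f ∈ V → ∀ s : Rn n,
      thetaTransLp θ s f ∈ V) :
    ∃ Ω : Set (Rn n), MeasurableSet Ω ∧
      ∀ f : Lp ℂ 2 (volume : Measure (Rn n)),
        f ∈ V ↔ ∀ᵐ ω ∂(volume : Measure (Rn n)), ω ∉ Ω → (F f : Rn n → ℂ) ω = 0 := by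
  let W := V.map F.toLinearEquiv.toLinearMap
  have hWclosed : IsClosed (W : Set (Lp ℂ 2 (volume : Measure (Rn n)))) :=
    F.toHomeomorph.isClosedMap _ hVclosed
  have hdisj : ∀ g ∈ W, ∀ h ∈ Wᗮ, ∀ᵐ ω, conj (h ω) * g ω = 0 := by
    rintro _ ⟨f, hf, rfl⟩ h hh
    refine ae_eq_zero_of_integral_thetaChar_mul_eq_zero hθ
      ((Lp.memLp h).star.integrable_mul (Lp.memLp (F f))) fun s => ?_
    have hperp := W.inner_left_of_mem_orthogonal (V.mem_map_of_mem (hVinv f hf s)) hh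
    rw [L2.inner_def] at hperp
    rw [← hperp]
    refine integral_congr_ae ?_
    filter_upwards [hF.coeFn_thetaTransLp s f] with ω hω
    change _ = inner ℂ (h ω) (F (thetaTransLp θ s f) ω)
    rw [hω, RCLike.inner_apply]
    change thetaChar θ s ω * (conj (h ω) * F f ω) = _
    ring
  obtain ⟨Ω, hΩ, hmem⟩ := exists_measurableSet_of_disjoint_supports W hWclosed hdisj
  refine ⟨Ω, hΩ, fun f => ?_⟩
  rw [← hmem (F f)]
  exact (Function.Injective.mem_set_image F.injective).symm
end
end

section
/- Let m, ℓ ∈ ℕ, let f₁,…,f_m ∈ L²(ℝⁿ), let N ∈ ℕ with N ≥ ℓ, set C_N := [−(N+1/2), N+1/2]ⁿ, and let M_N^{ℓ,θ} be the collection of all measurable sets Ω ⊆ C_N that are fractional ℓ multi-tiles of ℝⁿ. Then there exists Ω* ∈ M_N^{ℓ,θ} such that Σ_{j=1}^m ‖f_j − P_{V_{Ω*}^θ} f_j‖² ≤ Σ_{j=1}^m ‖f_j − P_{V_Ω^θ} f_j‖² for every Ω ∈ M_N^{ℓ,θ}; that is, V_{Ω*}^θ minimizes the approximation error Σ_{j=1}^m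 ‖f_j − P_V f_j‖² over all V = V_Ω^θ with Ω ∈ M_N^{ℓ,θ}. -/
noncomputable section

open MeasureTheory Complex
open scoped InnerProductSpace ENNReal

variable {n : ℕ}

/-- The embedding `ℤⁿ ↪ ℝⁿ`. -/
def zcast {n : ℕ} (k : Fin n → ℤ) : Rn n :=
  (WithLp.equiv 2 (Fin n → ℝ)).symm fun i => (k i : ℝ)

/-- `Ω` is a fractional `ℓ` multi-tile: `Σ_{k∈ℤⁿ} χ_Ω(ω + k sin θ) = ℓ` for a.e. `ω`. -/
def IsFracMultiTile {n : ℕ} (θ : ℝ) (Ω : Set (Rn n)) (ℓ : ℕ) : Prop :=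
  ∀ᵐ ω ∂(volume : Measure (Rn n)),
    (∑' k : Fin n → ℤ, Set.indicator Ω (fun _ => (1 : ℝ)) (ω + Real.sin θ • zcast k)) = (ℓ : ℝ)

/-- The cube `C_N = [-(N+1/2), N+1/2]ⁿ`. -/
def cubeN (n N : ℕ) : Set (Rn n) :=
  {x | ∀ i, x i ∈ Set.Icc (-((N : ℝ) + 1 / 2)) ((N : ℝ) + 1 / 2)}

/-- `g ∈ V_Ω^θ`, i.e. `F_θ g` vanishes a.e. outside `Ω`. -/
def MemVOmega {n : ℕ}
    (F : Lp ℂ 2 (volume : Measure (Rn n)) ≃ₗᵢ[ℂ] Lp ℂ 2 (volume : Measure (Rn n)))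
    (Ω : Set (Rn n)) (g : Lp ℂ 2 (volume : Measure (Rn n))) : Prop :=
  ∀ᵐ ω ∂(volume : Measure (Rn n)), ω ∉ Ω → (F g : Rn n → ℂ) ω = 0

section TopElements

variable {α β : Type*} [LinearOrder β]

/-- The elements of `T` with fewer than `ℓ` elements of `T` of larger key. -/
def topElements (T : Finset α) (key : α → β) (ℓ : ℕ) : Finset α :=
  T.filter fun k => (T.filter fun j => key k < key j).card < ℓ

lemma topElements_subset (T : Finset α) (key : α → β) (ℓ : ℕ) : topElements T key ℓ ⊆ T :=
  Finset.filter_subset _ _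

lemma card_topElements (T : Finset α) {key : α → β} (hkey : Function.Injective key) (ℓ : ℕ) :
    (topElements T key ℓ).card = min ℓ T.card := by
  classical
  induction T using Finset.induction_on_min_value key with
  | empty => simp [topElements]
  | insert a s ha hmin ih =>
    have hlt : ∀ x ∈ s, key a < key x := fun x hx =>
      lt_of_le_of_ne (hmin x hx) fun h => ha (hkey h ▸ hx)
    have hself : ((insert a s).filter fun j => key a < key j) = s := by
      ext j
      simp only [Finset.mem_filter, Finset.mem_insert]
      constructor
      · rintro ⟨rfl | h, h'⟩
        · exact absurd h' (lt_irrefl _)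
        · exact h
      · exact fun h => ⟨Or.inr h, hlt j h⟩
    have hother : ∀ k ∈ s, ((insert a s).filter fun j => key k < key j) =
        s.filter fun j => key k < key j := by
      intro k hk
      rw [Finset.filter_insert, if_neg (hlt k hk).not_gt]
    have hsplit : topElements (insert a s) key ℓ =
        if s.card < ℓ then insert a (topElements s key ℓ) else topElements s key ℓ := by
      unfold topElements
      rw [Finset.filter_insert, hself]
      have : (s.filter fun k => ((insert a s).filter fun j => key k < key j).card < ℓ) =
          s.filter fun k => (s.filter fun j => key k < key j).card < ℓ :=
        Finset.filter_congr fun k hk => by rw [hother k hk]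
      rw [this]
    rw [hsplit, Finset.card_insert_of_notMem ha]
    split_ifs with h
    · rw [Finset.card_insert_of_notMem fun h' => ha (topElements_subset _ _ _ h'), ih]
      omega
    · rw [ih]
      omega

lemma sum_le_sum_topElements (T S : Finset α) {key : α → β} (hkey : Function.Injective key)
    {φ : α → ℝ≥0∞} (hφ : ∀ a b, key a < key b → φ a ≤ φ b) (hS : S ⊆ T) :
    ∑ k ∈ S, φ k ≤ ∑ k ∈ topElements T key S.card, φ k := by
  classical
  set U := topElements T key S.card with hU
  have hcard : U.card = S.card := by
    rw [hU, card_topElements T hkey, min_eq_left (Finset.card_le_card hS)]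
  have hlt : ∀ a ∈ S \ U, ∀ b ∈ U \ S, φ a ≤ φ b := by
    intro a ha b hb
    rw [Finset.mem_sdiff] at ha hb
    refine hφ a b (lt_of_not_ge fun hba => ha.2 ?_)
    have hb' := (Finset.mem_filter.1 hb.1).2
    refine Finset.mem_filter.2 ⟨hS ha.1, lt_of_le_of_lt (Finset.card_le_card ?_) hb'⟩
    exact Finset.monotone_filter_right _ fun j _ hj => lt_of_le_of_lt hba hj
  have hdiff : (S \ U).card = (U \ S).card := by
    have h1 := Finset.card_sdiff_add_card_inter S U
    have h2 := Finset.card_sdiff_add_card_inter U S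
    rw [Finset.inter_comm] at h2
    omega
  have hmain : ∑ k ∈ S \ U, φ k ≤ ∑ k ∈ U \ S, φ k := by
    rcases (U \ S).eq_empty_or_nonempty with h | h
    · rw [h, Finset.card_empty, Finset.card_eq_zero] at hdiff
      simp [h, hdiff]
    · obtain ⟨b, hb, hmin⟩ := Finset.exists_min_image (U \ S) φ h
      calc ∑ k ∈ S \ U, φ k ≤ (S \ U).card • φ b :=
            Finset.sum_le_card_nsmul _ _ _ fun a ha => hlt a ha b hb
        _ = (U \ S).card • φ b := by rw [hdiff]
        _ ≤ ∑ k ∈ U \ S, φ k := Finset.card_nsmul_le_sum _ _ _ hmin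
  rw [← Finset.sum_inter_add_sum_sdiff S U, ← Finset.sum_inter_add_sum_sdiff U S,
    Finset.inter_comm U S]
  gcongr

end TopElements

lemma zcast_apply (k : Fin n → ℤ) (i : Fin n) : zcast k i = (k i : ℝ) := rfl

lemma zcast_add (k j : Fin n → ℤ) : zcast (k + j) = zcast k + zcast j := by
  ext i
  simp [zcast_apply]

/-- The lattice basis `s e₁, …, s eₙ`. -/
def scaledBasis (n : ℕ) {s : ℝ} (hs : s ≠ 0) : Module.Basis (Fin n) ℝ (Rn n) :=
  (EuclideanSpace.basisFun (Fin n) ℝ).toBasis.isUnitSMul (w := fun _ => s) fun _ => hs.isUnit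

lemma sum_zsmul_scaledBasis {s : ℝ} (hs : s ≠ 0) (k : Fin n → ℤ) :
    ∑ i, k i • scaledBasis n hs i = s • zcast k := by
  ext j
  simp [scaledBasis, Module.Basis.isUnitSMul_apply, zcast_apply, Finset.sum_apply, Pi.single_apply,
    mul_comm]

/-- The scaled integer vectors parametrize the lattice. -/
def latticeEquiv {s : ℝ} (hs : s ≠ 0) :
    (Fin n → ℤ) ≃ Submodule.span ℤ (Set.range (scaledBasis n hs)) :=
  Equiv.ofBijective
    (fun k => ⟨s • zcast k,
      Submodule.mem_span_range_iff_exists_fun ℤ |>.2 ⟨k, sum_zsmul_scaledBasis hs k⟩⟩) <| by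
    constructor
    · intro k j h
      have h' : s • zcast k = s • zcast j := congrArg Subtype.val h
      have h'' := smul_right_injective _ hs h'
      ext i
      have := congrArg (fun v : Rn n => v i) h''
      simpa [zcast_apply] using this
    · rintro ⟨v, hv⟩
      obtain ⟨k, hk⟩ := (Submodule.mem_span_range_iff_exists_fun ℤ).1 hv
      exact ⟨k, Subtype.ext ((sum_zsmul_scaledBasis hs k).symm.trans hk)⟩

lemma lintegral_eq_lintegral_tsum_zcast {s : ℝ} (hs : s ≠ 0) {g : Rn n → ℝ≥0∞}
    (hg : Measurable g) :
    ∫⁻ x, g x = ∫⁻ x in ZSpan.fundamentalDomain (scaledBasis n hs),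
      ∑' k : Fin n → ℤ, g (x + s • zcast k) := by
  have : Countable (Submodule.span ℤ (Set.range (scaledBasis n hs))).toAddSubgroup :=
    (latticeEquiv hs).symm.injective.countable
  have hD := ZSpan.isAddFundamentalDomain' (scaledBasis n hs) (volume : Measure (Rn n))
  rw [hD.lintegral_eq_tsum'', lintegral_tsum fun k => by fun_prop]
  refine ((latticeEquiv (n := n) hs).tsum_eq fun v => ∫⁻ x in ZSpan.fundamentalDomain (scaledBasis n hs),
    g ((v : Rn n) + x)).symm.trans (tsum_congr fun k => lintegral_congr fun x => ?_)
  rw [add_comm]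
  rfl

lemma finite_setOf_add_smul_zcast_mem_cubeN {s : ℝ} (hs : s ≠ 0) (N : ℕ) (x : Rn n) :
    {k : Fin n → ℤ | x + s • zcast k ∈ cubeN n N}.Finite := by
  set R : Fin n → ℤ := fun i => ⌈((N : ℝ) + 1 / 2 + |x i|) / |s|⌉
  refine (Set.finite_Icc (-R) R).subset fun k hk => ?_
  have hb : ∀ i, |k i| ≤ R i := by
    intro i
    have h := hk i
    simp only [PiLp.add_apply, PiLp.smul_apply, smul_eq_mul, zcast_apply, Set.mem_Icc,
      ← abs_le] at h
    have h1 : |s * (k i : ℝ)| ≤ (N : ℝ) + 1 / 2 + |x i| := by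
      calc |s * (k i : ℝ)| = |(x i + s * k i) - x i| := by ring_nf
        _ ≤ |x i + s * k i| + |x i| := abs_sub _ _
        _ ≤ _ := by gcongr
    have h2 : |(k i : ℝ)| ≤ ((N : ℝ) + 1 / 2 + |x i|) / |s| := by
      rw [le_div_iff₀ (abs_pos.2 hs), mul_comm, ← abs_mul]
      exact h1
    exact_mod_cast h2.trans (Int.le_ceil _)
  exact ⟨fun i => (abs_le.1 (hb i)).1, fun i => (abs_le.1 (hb i)).2⟩

/-- The lattice indices moving `x` into the cube `C_N`. -/
def cubeIndices {s : ℝ} (hs : s ≠ 0) (N : ℕ) (x : Rn n) : Finset (Fin n → ℤ) :=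
  (finite_setOf_add_smul_zcast_mem_cubeN hs N x).toFinset

lemma mem_cubeIndices {s : ℝ} (hs : s ≠ 0) {N : ℕ} {x : Rn n} {k : Fin n → ℤ} :
    k ∈ cubeIndices hs N x ↔ x + s • zcast k ∈ cubeN n N := by
  simp [cubeIndices]

lemma le_card_cubeIndices (hn : 1 ≤ n) {s : ℝ} (hs : s ≠ 0) (hs1 : |s| ≤ 1) (N : ℕ) (x : Rn n) :
    N ≤ (cubeIndices hs N x).card := by
  have hinj : Function.Injective
      (fun (j : ℕ) (i : Fin n) => -round (x i / s) + (j : ℤ)) := by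
    intro a b hab
    have := congrFun hab ⟨0, hn⟩
    simpa using this
  refine (Finset.card_range N).ge.trans ?_
  rw [← Finset.card_image_of_injective _ hinj]
  refine Finset.card_le_card (Finset.image_subset_iff.2 fun j hj => ?_)
  rw [mem_cubeIndices]
  intro i
  have hjN : (j : ℝ) ≤ N := by exact_mod_cast (Finset.mem_range.1 hj).le
  simp only [PiLp.add_apply, PiLp.smul_apply, smul_eq_mul, zcast_apply, Set.mem_Icc, ← abs_le]
  push_cast
  have hround : |x i / s - round (x i / s)| ≤ 1 / 2 := abs_sub_round _
  have heq : x i + s * (-(round (x i / s) : ℝ) + j) = s * ((x i / s - round (x i / s)) + j) := by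
    field_simp
    ring
  rw [heq, abs_mul]
  calc |s| * |x i / s - round (x i / s) + j|
      ≤ 1 * |x i / s - round (x i / s) + j| := by gcongr
    _ ≤ |x i / s - round (x i / s)| + |(j : ℝ)| := by rw [one_mul]; exact abs_add_le _ _
    _ ≤ 1 / 2 + N := by rw [Nat.abs_cast]; gcongr
    _ = N + 1 / 2 := add_comm _ _

/-- Orbit indices ordered by the size of `Φ`, ties broken lexicographically. -/
def orbitKey (s : ℝ) (Φ : Rn n → ℝ≥0∞) (x : Rn n) (k : Fin n → ℤ) :
    ℝ≥0∞ ×ₗ Lex (Fin n → ℤ) :=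
  toLex (Φ (x + s • zcast k), toLex k)

lemma orbitKey_injective (s : ℝ) (Φ : Rn n → ℝ≥0∞) (x : Rn n) :
    Function.Injective (orbitKey s Φ x) := fun _ _ h =>
  toLex.injective (congrArg Prod.snd (toLex.injective h))

lemma orbitKey_lt_orbitKey {s : ℝ} {Φ : Rn n → ℝ≥0∞} {x : Rn n} {k j : Fin n → ℤ} :
    orbitKey s Φ x k < orbitKey s Φ x j ↔ Φ (x + s • zcast k) < Φ (x + s • zcast j) ∨
      Φ (x + s • zcast k) = Φ (x + s • zcast j) ∧ toLex k < toLex j := by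
  simp [orbitKey, Prod.Lex.toLex_lt_toLex]

/-- The points whose translate by `s k` lies in `C_N` and precedes them in the ordering by
decreasing `Φ`. -/
def beatenBy (N : ℕ) (s : ℝ) (Φ : Rn n → ℝ≥0∞) (k : Fin n → ℤ) : Set (Rn n) :=
  {x | x + s • zcast k ∈ cubeN n N ∧
    (Φ x < Φ (x + s • zcast k) ∨ Φ x = Φ (x + s • zcast k) ∧ 0 < toLex k)}

/-- The set selecting from each orbit of `s ℤⁿ` the `ℓ` points of `C_N` at which `Φ` is largest. -/
def optimalTile (N : ℕ) (s : ℝ) (Φ : Rn n → ℝ≥0∞) (ℓ : ℕ) : Set (Rn n) :=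
  {x ∈ cubeN n N | ∑' k, (beatenBy N s Φ k).indicator (1 : Rn n → ℝ≥0∞) x < ℓ}

lemma measurableSet_cubeN (n N : ℕ) : MeasurableSet (cubeN n N) := by
  have : cubeN n N = ⋂ i, (fun x : Rn n => x i) ⁻¹'
      Set.Icc (-((N : ℝ) + 1 / 2)) ((N : ℝ) + 1 / 2) := by
    ext x
    simp [cubeN]
  rw [this]
  exact MeasurableSet.iInter fun i => measurableSet_Icc.preimage (by fun_prop)

lemma measurableSet_optimalTile (N : ℕ) (s : ℝ) {Φ : Rn n → ℝ≥0∞} (hΦ : Measurable Φ) (ℓ : ℕ) :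
    MeasurableSet (optimalTile N s Φ ℓ) := by
  have hbeat : ∀ k, MeasurableSet (beatenBy N s Φ k) := by
    intro k
    have htr : Measurable fun x : Rn n => x + s • zcast k := by fun_prop
    refine ((measurableSet_cubeN n N).preimage htr).inter
      ((measurableSet_lt hΦ (hΦ.comp htr)).union
        ((measurableSet_eq_fun hΦ (hΦ.comp htr)).inter (.const _)))
  have hcount : Measurable fun x =>
      ∑' k, (beatenBy N s Φ k).indicator (1 : Rn n → ℝ≥0∞) x :=
    Measurable.tsum fun k => measurable_one.indicator (hbeat k)
  exact (measurableSet_cubeN n N).inter (measurableSet_lt hcount measurable_const)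

lemma add_smul_zcast_mem_optimalTile {s : ℝ} (hs : s ≠ 0) (N : ℕ) (Φ : Rn n → ℝ≥0∞) (ℓ : ℕ)
    (x : Rn n) (k : Fin n → ℤ) :
    x + s • zcast k ∈ optimalTile N s Φ ℓ ↔
      k ∈ topElements (cubeIndices hs N x) (orbitKey s Φ x) ℓ := by
  have hmem : ∀ j, x + s • zcast k ∈ beatenBy N s Φ j ↔
      k + j ∈ (cubeIndices hs N x).filter fun i => orbitKey s Φ x k < orbitKey s Φ x i := by
    intro j
    rw [Finset.mem_filter, mem_cubeIndices, orbitKey_lt_orbitKey, zcast_add, smul_add,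
      ← add_assoc, toLex_add, lt_add_iff_pos_right]
    rfl
  have hsum : ∑' j, (beatenBy N s Φ j).indicator (1 : Rn n → ℝ≥0∞) (x + s • zcast k) =
      (((cubeIndices hs N x).filter fun i => orbitKey s Φ x k < orbitKey s Φ x i).card :
        ℝ≥0∞) := by
    classical
    set A := (cubeIndices hs N x).filter fun i => orbitKey s Φ x k < orbitKey s Φ x i
    calc _ = ∑' j, (fun i => if i ∈ A then (1 : ℝ≥0∞) else 0) (k + j) :=
          tsum_congr fun j => by simp [Set.indicator_apply, hmem]
      _ = ∑' i, (if i ∈ A then (1 : ℝ≥0∞) else 0) :=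
          (Equiv.addLeft k).tsum_eq (fun i => if i ∈ A then (1 : ℝ≥0∞) else 0)
      _ = (A.card : ℝ≥0∞) := by
          rw [tsum_eq_sum (s := A) fun i hi => if_neg hi]
          simp
  simp only [optimalTile, Set.mem_ofPred_eq, topElements, Finset.mem_filter, hsum, mem_cubeIndices,
    Nat.cast_lt]

lemma tsum_indicator_orbit {M : Type*} [AddCommMonoid M] [TopologicalSpace M] {s : ℝ}
    {Ω : Set (Rn n)} (φ : Rn n → M) (x : Rn n) {S : Finset (Fin n → ℤ)}
    (hS : ∀ k, k ∈ S ↔ x + s • zcast k ∈ Ω) :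
    ∑' k : Fin n → ℤ, Ω.indicator φ (x + s • zcast k) = ∑ k ∈ S, φ (x + s • zcast k) := by
  rw [tsum_eq_sum (s := S) fun k hk => Set.indicator_of_notMem (mt (hS k).2 hk) _]
  exact Finset.sum_congr rfl fun k hk => Set.indicator_of_mem ((hS k).1 hk) _

lemma isFracMultiTile_optimalTile (hn : 1 ≤ n) {θ : ℝ} (hθ : Real.sin θ ≠ 0) {ℓ N : ℕ}
    (hN : ℓ ≤ N) (Φ : Rn n → ℝ≥0∞) : IsFracMultiTile θ (optimalTile N (Real.sin θ) Φ ℓ) ℓ := by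
  refine Filter.Eventually.of_forall fun x => ?_
  rw [tsum_indicator_orbit _ x fun k => (add_smul_zcast_mem_optimalTile hθ N Φ ℓ x k).symm,
    Finset.sum_const, card_topElements _ (orbitKey_injective _ _ _), min_eq_left
      (hN.trans (le_card_cubeIndices hn hθ (Real.abs_sin_le_one θ) N x))]
  simp

lemma setLIntegral_le_setLIntegral_optimalTile {θ : ℝ} (hθ : Real.sin θ ≠ 0) {ℓ N : ℕ}
    {Φ : Rn n → ℝ≥0∞} (hΦ : Measurable Φ) {Ω : Set (Rn n)} (hΩ : MeasurableSet Ω)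
    (hcube : Ω ⊆ cubeN n N) (htile : IsFracMultiTile θ Ω ℓ) :
    ∫⁻ x in Ω, Φ x ≤ ∫⁻ x in optimalTile N (Real.sin θ) Φ ℓ, Φ x := by
  classical
  have hopt := measurableSet_optimalTile N (Real.sin θ) hΦ ℓ
  rw [← lintegral_indicator hΩ, ← lintegral_indicator hopt,
    lintegral_eq_lintegral_tsum_zcast hθ (hΦ.indicator hΩ),
    lintegral_eq_lintegral_tsum_zcast hθ (hΦ.indicator hopt)]
  refine lintegral_mono_ae (ae_restrict_of_ae ?_)
  filter_upwards [htile] with x hx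
  set T := cubeIndices hθ N x
  have hS : ∀ k, k ∈ T.filter (fun k => x + Real.sin θ • zcast k ∈ Ω) ↔
      x + Real.sin θ • zcast k ∈ Ω := fun k => by
    rw [Finset.mem_filter, mem_cubeIndices]
    exact and_iff_right_of_imp fun h => hcube h
  have hcard : (T.filter fun k => x + Real.sin θ • zcast k ∈ Ω).card = ℓ := by
    rw [tsum_indicator_orbit _ x hS] at hx
    simpa using hx
  rw [tsum_indicator_orbit Φ x hS, tsum_indicator_orbit Φ x
    fun k => (add_smul_zcast_mem_optimalTile hθ N Φ ℓ x k).symm]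
  have := sum_le_sum_topElements T _ (orbitKey_injective (Real.sin θ) Φ x)
    (φ := fun k => Φ (x + Real.sin θ • zcast k))
    (fun a b hab => (orbitKey_lt_orbitKey.1 hab).elim le_of_lt fun h => h.1.le)
    (Finset.filter_subset (fun k => x + Real.sin θ • zcast k ∈ Ω) T)
  rwa [hcard] at this

lemma ofReal_norm_sq_eq_lintegral {α : Type*} [MeasurableSpace α] {μ : Measure α}
    (h : Lp ℂ 2 μ) : ENNReal.ofReal (‖h‖ ^ 2) = ∫⁻ x, ‖h x‖ₑ ^ 2 ∂μ := by
  have := eLpNorm_nnreal_pow_eq_lintegral (μ := μ) (f := h) (p := 2) two_ne_zero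
  rw [ENNReal.ofReal_pow (norm_nonneg _), ofReal_norm, Lp.enorm_def]
  simpa using this

section Projection

variable {F : Lp ℂ 2 (volume : Measure (Rn n)) ≃ₗᵢ[ℂ] Lp ℂ 2 (volume : Measure (Rn n))}
  {Ω : Set (Rn n)} {f P : Lp ℂ 2 (volume : Measure (Rn n))}

lemma setLIntegral_compl_le_of_memVOmega (hΩ : MeasurableSet Ω) (hP : MemVOmega F Ω P) :
    ∫⁻ x in Ωᶜ, ‖F f x‖ₑ ^ 2 ≤ ENNReal.ofReal (‖f - P‖ ^ 2) := by
  rw [← F.norm_map, map_sub, ofReal_norm_sq_eq_lintegral, ← lintegral_indicator hΩ.compl]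
  refine lintegral_mono_ae ?_
  filter_upwards [hP, Lp.coeFn_sub (F f) (F P)] with x hx hsub
  by_cases hxΩ : x ∈ Ω
  · simp [hxΩ]
  · rw [hsub, Pi.sub_apply, hx hxΩ, sub_zero, Set.indicator_of_mem hxΩ]

lemma ofReal_norm_sub_sq_le_setLIntegral_compl (hΩ : MeasurableSet Ω) (hP : MemVOmega F Ω P)
    (horth : ∀ g, MemVOmega F Ω g → ⟪f - P, g⟫_ℂ = 0) :
    ENNReal.ofReal (‖f - P‖ ^ 2) ≤ ∫⁻ x in Ωᶜ, ‖F f x‖ₑ ^ 2 := by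
  have hmem : MemLp (Ω.indicator (F f)) 2 (volume : Measure (Rn n)) :=
    (Lp.memLp (F f)).indicator hΩ
  set h := hmem.toLp _ with hh
  set g := F.symm h
  have hFg : F g = h := F.apply_symm_apply h
  have hgV : MemVOmega F Ω g := by
    unfold MemVOmega
    rw [hFg]
    filter_upwards [hmem.coeFn_toLp] with x hx hxΩ
    rw [hx, Set.indicator_of_notMem hxΩ]
  have hle : ‖f - P‖ ^ 2 ≤ ‖f - g‖ ^ 2 := by
    have hpyth := norm_add_sq_eq_norm_sq_add_norm_sq_of_inner_eq_zero (𝕜 := ℂ) (f - P) (P - g)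
      (by rw [inner_sub_right, horth P hP, horth g hgV, sub_zero])
    rw [sub_add_sub_cancel] at hpyth
    nlinarith [norm_nonneg (P - g)]
  refine (ENNReal.ofReal_le_ofReal hle).trans (le_of_eq ?_)
  rw [← F.norm_map, map_sub, hFg, ofReal_norm_sq_eq_lintegral, ← lintegral_indicator hΩ.compl]
  refine lintegral_congr_ae ?_
  filter_upwards [hmem.coeFn_toLp, Lp.coeFn_sub (F f) h] with x hx hsub
  rw [hsub, Pi.sub_apply, hh, hx]
  by_cases hxΩ : x ∈ Ω <;> simp [hxΩ]

end Projection

/-- Among all `V_Ω^θ` with `Ω ⊆ C_N` a measurable fractional `ℓ`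
multi-tile, there is an optimal `Ω*` minimizing `Σ_j ‖f_j − P_{V_Ω^θ} f_j‖²`. -/
theorem statement18 (n : ℕ) (hn : 1 ≤ n) (θ : ℝ) (hθ : Real.sin θ ≠ 0)
    (F : Lp ℂ 2 (volume : Measure (Rn n)) ≃ₗᵢ[ℂ] Lp ℂ 2 (volume : Measure (Rn n)))
    (hF : IsFrftL2 θ F)
    (m ℓ N : ℕ) (hm : 1 ≤ m) (hℓ : 1 ≤ ℓ) (hN : ℓ ≤ N)
    (f : Fin m → Lp ℂ 2 (volume : Measure (Rn n))) :
    ∃ Ωstar : Set (Rn n),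
      (MeasurableSet Ωstar ∧ Ωstar ⊆ cubeN n N ∧ IsFracMultiTile θ Ωstar ℓ) ∧
      ∀ Ω : Set (Rn n), MeasurableSet Ω → Ω ⊆ cubeN n N → IsFracMultiTile θ Ω ℓ →
        ∀ Pv Pw : Fin m → Lp ℂ 2 (volume : Measure (Rn n)),
          -- `Pv i` is the orthogonal projection of `f i` onto `V_{Ω*}^θ`:
          (∀ i, MemVOmega F Ωstar (Pv i) ∧
            ∀ g : Lp ℂ 2 (volume : Measure (Rn n)), MemVOmega F Ωstar g →
              ⟪f i - Pv i, g⟫_ℂ = (0 : ℂ)) →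
          -- `Pw i` is the orthogonal projection of `f i` onto `V_Ω^θ`:
          (∀ i, MemVOmega F Ω (Pw i) ∧
            ∀ g : Lp ℂ 2 (volume : Measure (Rn n)), MemVOmega F Ω g →
              ⟪f i - Pw i, g⟫_ℂ = (0 : ℂ)) →
          ∑ i, ‖f i - Pv i‖ ^ 2 ≤ ∑ i, ‖f i - Pw i‖ ^ 2 := by
  set Φ : Rn n → ℝ≥0∞ := fun x => ∑ i, ‖F (f i) x‖ₑ ^ 2
  have hmeas : ∀ i, Measurable fun x => ‖F (f i) x‖ₑ ^ 2 := fun i =>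
    (Lp.stronglyMeasurable (F (f i))).enorm.pow_const 2
  have hΦ : Measurable Φ := Finset.measurable_sum _ fun i _ => hmeas i
  have hsum : ∀ A : Set (Rn n), ∫⁻ x in A, Φ x = ∑ i, ∫⁻ x in A, ‖F (f i) x‖ₑ ^ 2 := fun A =>
    lintegral_finsetSum _ fun i _ => hmeas i
  have hfin : ∫⁻ x, Φ x ≠ ∞ := by
    rw [← setLIntegral_univ, hsum]
    simp [← ofReal_norm_sq_eq_lintegral]
  have hopt := measurableSet_optimalTile N (Real.sin θ) hΦ ℓ
  refine ⟨optimalTile N (Real.sin θ) Φ ℓ,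
    ⟨hopt, fun x hx => hx.1, isFracMultiTile_optimalTile hn hθ hN Φ⟩, ?_⟩
  intro Ω hΩ hcube htile Pv Pw hPv hPw
  have hle : ∫⁻ x in (optimalTile N (Real.sin θ) Φ ℓ)ᶜ, Φ x ≤ ∫⁻ x in Ωᶜ, Φ x := by
    have h1 := lintegral_add_compl (μ := volume) Φ hopt
    rw [← lintegral_add_compl (μ := volume) Φ hΩ] at h1
    have hne : ∫⁻ x in Ω, Φ x ≠ ∞ := ne_top_of_le_ne_top hfin (setLIntegral_le_lintegral _ _)
    refine (ENNReal.add_le_add_iff_left hne).1 ?_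
    rw [← h1]
    exact add_le_add_left (setLIntegral_le_setLIntegral_optimalTile hθ hΦ hΩ hcube htile) _
  rw [← ENNReal.ofReal_le_ofReal_iff (by positivity),
    ENNReal.ofReal_sum_of_nonneg fun _ _ => by positivity,
    ENNReal.ofReal_sum_of_nonneg fun _ _ => by positivity]
  calc ∑ i, ENNReal.ofReal (‖f i - Pv i‖ ^ 2)
      ≤ ∑ i, ∫⁻ x in (optimalTile N (Real.sin θ) Φ ℓ)ᶜ, ‖F (f i) x‖ₑ ^ 2 :=
        Finset.sum_le_sum fun i _ =>
          ofReal_norm_sub_sq_le_setLIntegral_compl hopt (hPv i).1 (hPv i).2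
    _ ≤ ∑ i, ∫⁻ x in Ωᶜ, ‖F (f i) x‖ₑ ^ 2 := by rwa [← hsum, ← hsum]
    _ ≤ ∑ i, ENNReal.ofReal (‖f i - Pw i‖ ^ 2) :=
        Finset.sum_le_sum fun i _ => setLIntegral_compl_le_of_memVOmega hΩ (hPw i).1
end
end
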